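/- Let A ⊆ [0,1]² be a measurable set, n ∈ ℕ, i,j,k ∈ {1,…,2ⁿ} with j ≠ k, and let A' = σⁿ_{ijk}(A). Assume ((Qⁿ_{ik} ∩ A) − (2⁻ⁿ(k−j), 0)) ⊊ Qⁿ_{ij} ∩ A. Then |A ∖ A'| = ∫_{Xⁿ_j} (v_A(x) − v_{A'}(x)) dx and |A' ∖ A| = ∫_{Xⁿ_k} (v_{A'}(x) − v_A(x)) dx. -/

import Mathlib

open MeasureTheory

/-- The dyadic interval `Xⁿ_j = [2⁻ⁿ(j−1), 2⁻ⁿj)`. -/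
def dyadX (n j : ℕ) : Set ℝ := Set.Ico (((j : ℝ) - 1) / 2 ^ n) ((j : ℝ) / 2 ^ n)

/-- The dyadic square `Qⁿ_{ij} = Xⁿ_j × Yⁿ_i`. -/
def dyadQ (n i j : ℕ) : Set (ℝ × ℝ) := dyadX n j ×ˢ dyadX n i

/-- The shifted set `Q + (x₀, y₀) = {(x,y) : (x−x₀, y−y₀) ∈ Q}`. -/
def shiftSet (Q : Set (ℝ × ℝ)) (v : ℝ × ℝ) : Set (ℝ × ℝ) :=
  {p | (p.1 - v.1, p.2 - v.2) ∈ Q}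

/-- The vertical cross section `v_A(x) = ∫₀¹ χ_A(x,z) dz`. -/
noncomputable def vSec (A : Set (ℝ × ℝ)) (x : ℝ) : ℝ :=
  ∫ z in (0 : ℝ)..1, A.indicator (fun _ => (1 : ℝ)) (x, z)

/-- The horizontal cross section `h_A(y) = ∫₀¹ χ_A(z,y) dz`. -/
noncomputable def hSec (A : Set (ℝ × ℝ)) (y : ℝ) : ℝ :=
  ∫ z in (0 : ℝ)..1, A.indicator (fun _ => (1 : ℝ)) (z, y)

/-- The horizontal swapping `σⁿ_{ijk}(A)`: the contents of `A` inside the squares `Qⁿ_{ij}`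
and `Qⁿ_{ik}` change places. -/
def swapSet (n i j k : ℕ) (A : Set (ℝ × ℝ)) : Set (ℝ × ℝ) :=
  (A \ (dyadQ n i j ∪ dyadQ n i k)) ∪
    shiftSet (dyadQ n i j ∩ A) (((k : ℝ) - (j : ℝ)) / 2 ^ n, 0) ∪
    shiftSet (dyadQ n i k ∩ A) (-(((k : ℝ) - (j : ℝ)) / 2 ^ n), 0)

theorem vSec_eq_measureReal {C : Set (ℝ × ℝ)} (hC : MeasurableSet C)
    (hC1 : C ⊆ Prod.snd ⁻¹' Set.Icc (0 : ℝ) 1) (x : ℝ) :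
    vSec C x = volume.real (Prod.mk x ⁻¹' C) := by
  have hm : MeasurableSet (Prod.mk x ⁻¹' C) := measurable_prodMk_left hC
  have hs : Prod.mk x ⁻¹' C ⊆ Set.Icc (0 : ℝ) 1 := fun z hz => hC1 hz
  have hi : (fun z => C.indicator (fun _ => (1 : ℝ)) (x, z)) =
      (Prod.mk x ⁻¹' C).indicator fun _ => (1 : ℝ) := rfl
  rw [vSec, intervalIntegral.integral_of_le zero_le_one, ← integral_Icc_eq_integral_Ioc, hi,
    setIntegral_indicator hm, Set.inter_eq_self_of_subset_right hs]
  simp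

/-- If `C ∖ B` lies over `X` and `B ⊆ C` over `X`, then the measure of `C ∖ B` is the integral over
`X` of the difference of the vertical cross sections. -/
theorem measure_diff_eq_integral_vSec_sub {B C : Set (ℝ × ℝ)} {X : Set ℝ}
    (hB : MeasurableSet B) (hC : MeasurableSet C) (hX : MeasurableSet X)
    (hB1 : B ⊆ Prod.snd ⁻¹' Set.Icc (0 : ℝ) 1) (hC1 : C ⊆ Prod.snd ⁻¹' Set.Icc (0 : ℝ) 1)
    (hdiff : ∀ p ∈ C \ B, p.1 ∈ X) (hBC : ∀ p ∈ B, p.1 ∈ X → p ∈ C) :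
    (volume (C \ B)).toReal = ∫ x in X, (vSec C x - vSec B x) := by
  have hfin : ∀ {D : Set (ℝ × ℝ)}, D ⊆ Prod.snd ⁻¹' Set.Icc (0 : ℝ) 1 → ∀ x : ℝ,
      volume (Prod.mk x ⁻¹' D) < ⊤ := fun hD x =>
    (measure_mono (fun z hz => hD hz : Prod.mk x ⁻¹' _ ⊆ Set.Icc (0 : ℝ) 1)).trans_lt
      measure_Icc_lt_top
  have hmeas := measurable_measure_prodMk_left (ν := (volume : Measure ℝ)) (hC.diff hB)
  have hsupp : Function.support (fun x => volume (Prod.mk x ⁻¹' (C \ B))) ⊆ X := by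
    intro x hx
    obtain ⟨z, hz⟩ := nonempty_of_measure_ne_zero hx
    exact hdiff _ hz
  rw [Measure.volume_eq_prod, Measure.prod_apply (hC.diff hB),
    ← setLIntegral_eq_of_support_subset hsupp,
    ← integral_toReal hmeas.aemeasurable
      (ae_of_all _ fun x => hfin (Set.sdiff_subset.trans hC1) x)]
  refine setIntegral_congr_fun hX fun x hx => ?_
  simp only [vSec_eq_measureReal hC hC1, vSec_eq_measureReal hB hB1]
  have hslice : Prod.mk x ⁻¹' B ⊆ Prod.mk x ⁻¹' C := fun z hz => hBC _ hz hx
  exact measureReal_sdiff hslice (measurable_prodMk_left hB) (hfin hC1 x).ne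

theorem measurableSet_dyadX (n j : ℕ) : MeasurableSet (dyadX n j) := measurableSet_Ico

theorem measurableSet_dyadQ (n i j : ℕ) : MeasurableSet (dyadQ n i j) :=
  (measurableSet_dyadX n j).prod (measurableSet_dyadX n i)

theorem measurableSet_shiftSet {Q : Set (ℝ × ℝ)} (hQ : MeasurableSet Q) (v : ℝ × ℝ) :
    MeasurableSet (shiftSet Q v) :=
  ((measurable_fst.sub_const v.1).prodMk (measurable_snd.sub_const v.2)) hQ

theorem measurableSet_swapSet {A : Set (ℝ × ℝ)} (hA : MeasurableSet A) (n i j k : ℕ) :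
    MeasurableSet (swapSet n i j k A) :=
  ((hA.diff ((measurableSet_dyadQ n i j).union (measurableSet_dyadQ n i k))).union
    (measurableSet_shiftSet ((measurableSet_dyadQ n i j).inter hA) _)).union
    (measurableSet_shiftSet ((measurableSet_dyadQ n i k).inter hA) _)

theorem swapSet_subset_preimage_snd {A : Set (ℝ × ℝ)} {Y : Set ℝ} (hA : A ⊆ Prod.snd ⁻¹' Y)
    (n i j k : ℕ) : swapSet n i j k A ⊆ Prod.snd ⁻¹' Y := by
  rintro p ((hp | hp) | hp)
  · exact hA hp.1
  · simpa using hA hp.2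
  · simpa using hA hp.2

theorem eq_of_mem_dyadX {n j k : ℕ} {x : ℝ} (hj : x ∈ dyadX n j) (hk : x ∈ dyadX n k) :
    j = k := by
  have h2 : (0 : ℝ) < 2 ^ n := by positivity
  have h1 : (j : ℝ) - 1 < k := (div_lt_div_iff_of_pos_right h2).1 (hj.1.trans_lt hk.2)
  have h3 : (k : ℝ) - 1 < j := (div_lt_div_iff_of_pos_right h2).1 (hk.1.trans_lt hj.2)
  have h1' : j < k + 1 := by exact_mod_cast sub_lt_iff_lt_add.1 h1
  have h3' : k < j + 1 := by exact_mod_cast sub_lt_iff_lt_add.1 h3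
  omega

theorem sub_mem_dyadX_iff {n j k : ℕ} {x : ℝ} :
    x - ((k : ℝ) - j) / 2 ^ n ∈ dyadX n j ↔ x ∈ dyadX n k := by
  rw [dyadX, dyadX, Set.sub_mem_Ico_iff_left]
  ring_nf

/-- The measures of `A ∖ A'` and `A' ∖ A` as integrals of differences of vertical cross
sections over `Xⁿ_j` and `Xⁿ_k`, respectively. -/
theorem swap_diff_measure (A : Set (ℝ × ℝ)) (hA : MeasurableSet A)
    (hsub : A ⊆ Set.Icc (0 : ℝ) 1 ×ˢ Set.Icc (0 : ℝ) 1)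
    (n i j k : ℕ) (hi : 1 ≤ i) (hi' : i ≤ 2 ^ n) (hj : 1 ≤ j) (hj' : j ≤ 2 ^ n)
    (hk : 1 ≤ k) (hk' : k ≤ 2 ^ n) (hjk : j ≠ k)
    (hstrict : shiftSet (dyadQ n i k ∩ A) (-(((k : ℝ) - (j : ℝ)) / 2 ^ n), 0) ⊂
      dyadQ n i j ∩ A) :
    (volume (A \ swapSet n i j k A)).toReal =
        ∫ x in dyadX n j, (vSec A x - vSec (swapSet n i j k A) x) ∧
      (volume (swapSet n i j k A \ A)).toReal =
        ∫ x in dyadX n k, (vSec (swapSet n i j k A) x - vSec A x) := by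
  have hA1 : A ⊆ Prod.snd ⁻¹' Set.Icc (0 : ℝ) 1 := fun p hp => (hsub hp).2
  have hS := measurableSet_swapSet hA n i j k
  have hS1 := swapSet_subset_preimage_snd hA1 n i j k
  have hmemA : ∀ p ∈ A, p.1 ∈ dyadX n k → p ∈ swapSet n i j k A := by
    intro p hp hpk
    by_cases hpi : p.2 ∈ dyadX n i
    · refine Or.inl (Or.inr (hstrict.subset ?_))
      simpa [shiftSet, dyadQ] using ⟨⟨hpk, hpi⟩, hp⟩
    · exact Or.inl (Or.inl ⟨hp, fun h => h.elim (fun h => hpi h.2) fun h => hpi h.2⟩)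
  have hmemS : ∀ p ∈ swapSet n i j k A, p.1 ∉ dyadX n k → p ∈ A := by
    rintro p ((hp | hp) | hp) hpk
    · exact hp.1
    · exact absurd (sub_mem_dyadX_iff.1 hp.1.1) hpk
    · exact (hstrict.subset hp).2
  refine ⟨measure_diff_eq_integral_vSec_sub hS hA (measurableSet_dyadX n j) hS1 hA1 ?_ ?_,
    measure_diff_eq_integral_vSec_sub hA hS (measurableSet_dyadX n k) hA1 hS1 ?_ hmemA⟩
  · rintro p ⟨hp, hpS⟩
    by_contra hpj
    refine hpS (Or.inl (Or.inl ⟨hp, fun h => h.elim (fun h => hpj h.1) fun h => ?_⟩))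
    exact hpS (hmemA p hp h.1)
  · exact fun p hp hpj => hmemS p hp fun hpk => hjk (eq_of_mem_dyadX hpj hpk)
  · exact fun p hp => by_contra fun hpk => hp.2 (hmemS p hp.1 hpk)
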